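/- (Approximate multiplicativity.) Let 0 < ε < 1. For any s, t, u, v ∈ S and a, b, c, d ∈ A such that d((s, at), (u, cv)) ≤ ε and d((t, b), (v, d)) ≤ ε, one has d((s, ab), (u, cd)) ≤ ε · max over 1 ≤ i ≤ m of max(1, |at|ᵢ/|s|ᵢ, (|at|ᵢ/|s|ᵢ)·(|b|ᵢ/|t|ᵢ), |b|ᵢ/|t|ᵢ, |cv|ᵢ/|u|ᵢ, (|cv|ᵢ/|u|ᵢ)·(|d|ᵢ/|v|ᵢ), |d|ᵢ/|v|ᵢ). -/

import Mathlib

/-- A multiplicative nonarchimedean norm on a (possibly noncommutative) unital ring. -/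
def IsMultNorm {A : Type*} [Ring A] (f : A → ℝ) : Prop :=
  (∀ a, 0 ≤ f a) ∧ (∀ a, f a = 0 ↔ a = 0) ∧
  (∀ a b, f (a + b) ≤ max (f a) (f b)) ∧ f 1 = 1 ∧
  (∀ a b, f (a * b) = f a * f b)

/-- A quasi-abelian multiplicative norm: `|ab - ba| ≤ γ·|ab|` for some `0 < γ < 1`. -/
def IsQuasiAbelian {A : Type*} [Ring A] (f : A → ℝ) : Prop :=
  IsMultNorm f ∧ ∃ γ : ℝ, 0 < γ ∧ γ < 1 ∧ ∀ a b, f (a * b - b * a) ≤ γ * f (a * b)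

/-- The saturation of `S` with respect to the norm `f`. -/
def Sat {A : Type*} [Ring A] (f : A → ℝ) (S : Set A) : Set A :=
  {a | ∃ s ∈ S, ∃ t ∈ S, f (a * t - s) < f s}

/-- `Δ(x,y) = |s|⁻¹·|t|⁻¹·|at − sb|` for `x = (s,a)`, `y = (t,b)`. -/
noncomputable def Delta {A : Type*} [Ring A] (f : A → ℝ) (x y : A × A) : ℝ :=
  (f x.1)⁻¹ * (f y.1)⁻¹ * f (x.2 * y.1 - x.1 * y.2)

/-- `dᵢ(x,y)` : the infimum over `ξ ∈ Sᵢ × A` of `max(Δᵢ(x,ξ), Δᵢ(y,ξ))`. -/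
noncomputable def dI {A : Type*} [Ring A] (f : A → ℝ) (S : Set A) (x y : A × A) : ℝ :=
  sInf {r : ℝ | ∃ ξ : A × A, ξ.1 ∈ Sat f S ∧ r = max (Delta f x ξ) (Delta f y ξ)}

/-- `d(x,y) = maxᵢ dᵢ(x,y)`. -/
noncomputable def dGlob {A : Type*} [Ring A] {m : ℕ} (f : Fin m → A → ℝ)
    (S : Set A) (x y : A × A) : ℝ :=
  ⨆ i : Fin m, dI (f i) S x y

theorem delta_le_iff {A : Type*} [Ring A] {f : A → ℝ} {x y : A × A} (hx : 0 < f x.1)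
    (hy : 0 < f y.1) {r : ℝ} :
    Delta f x y ≤ r ↔ f (x.2 * y.1 - x.1 * y.2) ≤ r * (f x.1 * f y.1) := by
  rw [Delta, ← mul_inv, inv_mul_le_iff₀ (mul_pos hx hy), mul_comm r]

namespace IsMultNorm

variable {A : Type*} [Ring A] {f : A → ℝ}

theorem map_neg (hf : IsMultNorm f) (a : A) : f (-a) = f a := by
  obtain ⟨h0, -, -, h1, hmul⟩ := hf
  have h : f (-1) * f (-1) = 1 := by rw [← hmul]; simpa using h1
  have h' : f (-1) = 1 := by nlinarith [h0 (-1)]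
  rw [← neg_one_mul, hmul, h', one_mul]

theorem map_sub_le (hf : IsMultNorm f) (a b : A) : f (a - b) ≤ max (f a) (f b) := by
  have h := hf.2.2.1 a (-b)
  rwa [hf.map_neg, ← sub_eq_add_neg] at h

theorem pos (hf : IsMultNorm f) {a : A} (ha : a ≠ 0) : 0 < f a :=
  lt_of_le_of_ne (hf.1 a) fun h => ha ((hf.2.1 a).1 h.symm)

theorem map_eq_of_map_sub_lt (hf : IsMultNorm f) {a b : A} (h : f (a - b) < f b) :
    f a = f b := by
  apply le_antisymm
  · have := hf.2.2.1 (a - b) b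
    rw [sub_add_cancel] at this
    exact this.trans (max_le h.le le_rfl)
  · have := hf.map_sub_le a (a - b)
    rw [sub_sub_cancel] at this
    rcases le_max_iff.1 this with h' | h'
    · exact h'
    · exact absurd h (not_lt.2 h')

theorem pos_of_mem_sat (hf : IsMultNorm f) {S : Set A} {a : A} (ha : a ∈ Sat f S) :
    0 < f a := by
  obtain ⟨s, -, t, -, h⟩ := ha
  refine hf.pos ?_
  rintro rfl
  rw [zero_mul, zero_sub, hf.map_neg] at h
  exact lt_irrefl _ h

theorem one_mem_sat (hf : IsMultNorm f) {S : Set A} (h1 : (1 : A) ∈ S) :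
    (1 : A) ∈ Sat f S := by
  refine ⟨1, h1, 1, h1, ?_⟩
  rw [mul_one, sub_self, (hf.2.1 0).2 rfl, hf.2.2.2.1]
  exact one_pos

theorem delta_nonneg (hf : IsMultNorm f) (x y : A × A) : 0 ≤ Delta f x y :=
  mul_nonneg (mul_nonneg (inv_nonneg.2 (hf.1 _)) (inv_nonneg.2 (hf.1 _))) (hf.1 _)

theorem dI_le (hf : IsMultNorm f) {S : Set A} {x y ξ : A × A} {r : ℝ}
    (hξ : ξ.1 ∈ Sat f S) (hx : Delta f x ξ ≤ r) (hy : Delta f y ξ ≤ r) : dI f S x y ≤ r := by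
  rw [dI]
  refine le_trans (csInf_le ?_ ?_) (max_le hx hy)
  swap
  · exact ⟨ξ, hξ, rfl⟩
  refine ⟨0, ?_⟩
  rintro _ ⟨η, -, rfl⟩
  exact (hf.delta_nonneg _ _).trans (le_max_left _ _)

theorem exists_delta_lt_of_dI_lt (hf : IsMultNorm f) {S : Set A} (h1 : (1 : A) ∈ S)
    {x y : A × A} {r : ℝ} (h : dI f S x y < r) :
    ∃ ξ : A × A, ξ.1 ∈ Sat f S ∧ Delta f x ξ < r ∧ Delta f y ξ < r := by
  rw [dI] at h
  obtain ⟨_, ⟨ξ, hξ, rfl⟩, hlt⟩ := exists_lt_of_csInf_lt (by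
    exact ⟨_, ((1 : A), (0 : A)), hf.one_mem_sat h1, rfl⟩) h
  exact ⟨ξ, hξ, max_lt_iff.1 hlt⟩

/-- If `p r⁻¹` approximates `s⁻¹ a t`, `q w⁻¹` approximates `t⁻¹ b` and `q' r'⁻¹` approximates
`r⁻¹ q`, then `p q' (w r')⁻¹` approximates `s⁻¹ a b`. -/
theorem delta_mul_le (hf : IsMultNorm f) {s t a b r p w q r' q' : A} {ε M : ℝ}
    (hs : 0 < f s) (ht : 0 < f t) (hr : 0 < f r) (hw : 0 < f w) (hr' : 0 < f r')
    (hε0 : 0 ≤ ε) (hε1 : ε ≤ 1) (hM1 : 1 ≤ M) (hMa : f (a * t) / f s ≤ M)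
    (hMb : f b / f t ≤ M)
    (h1 : Delta f (s, a * t) (r, p) ≤ ε) (h2 : Delta f (t, b) (w, q) ≤ ε)
    (h3 : f (q * r' - r * q') ≤ ε * f w * f r') :
    Delta f (s, a * b) (w * r', p * q') ≤ ε * M := by
  have hadd := hf.2.2.1
  have hmul := hf.2.2.2.2
  have hnn := hf.1
  rw [delta_le_iff hs hr] at h1
  rw [delta_le_iff ht hw] at h2
  rw [delta_le_iff hs (by simpa [hmul] using mul_pos hw hr')]
  rw [div_le_iff₀ hs, hmul] at hMa
  rw [div_le_iff₀ ht] at hMb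
  dsimp only at h1 h2 ⊢
  have hM0 : 0 ≤ M := zero_le_one.trans hM1
  have hq : f q ≤ M * f w := by
    have h := hf.map_sub_le (b * w) (b * w - t * q)
    rw [sub_sub_cancel, hmul, hmul] at h
    refine le_of_mul_le_mul_left (h.trans (max_le ?_ (h2.trans ?_))) ht
    · nlinarith
    · nlinarith [mul_pos ht hw]
  have hrq' : f r * f q' ≤ M * f w * f r' := by
    have h := hf.map_sub_le (q * r') (q * r' - r * q')
    rw [sub_sub_cancel, hmul, hmul] at h
    refine h.trans (max_le (by gcongr) (h3.trans ?_))
    gcongr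
    exact hε1.trans hM1
  have key : a * b * (w * r') - s * (p * q') =
      a * (b * w - t * q) * r' + (a * t * (q * r' - r * q') + (a * t * r - s * p) * q') := by
    noncomm_ring
  rw [key, hmul w]
  refine (hadd _ _).trans (max_le ?_ ((hadd _ _).trans (max_le ?_ ?_)))
  · rw [hmul, hmul]
    calc f a * f (b * w - t * q) * f r' ≤ f a * (ε * (f t * f w)) * f r' := by
          have := hnn a
          gcongr
      _ = ε * (f a * f t) * (f w * f r') := by ring
      _ ≤ ε * (M * f s) * (f w * f r') := by gcongr
      _ = _ := by ring
  · rw [hmul, hmul]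
    calc f a * f t * f (q * r' - r * q') ≤ (M * f s) * (ε * f w * f r') := by
          have := hnn (q * r' - r * q')
          gcongr
      _ = _ := by ring
  · rw [hmul]
    calc f (a * t * r - s * p) * f q' ≤ ε * (f s * f r) * f q' := by
          have := hnn q'
          gcongr
      _ = ε * f s * (f r * f q') := by ring
      _ ≤ ε * f s * (M * f w * f r') := by gcongr
      _ = _ := by ring

end IsMultNorm

namespace IsQuasiAbelian

variable {A : Type*} [Ring A] {f : A → ℝ}

theorem mul_mem_sat (hf : IsQuasiAbelian f) {S : Set A} (h0 : (0 : A) ∉ S)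
    (hS : ∀ a ∈ S, ∀ b ∈ S, a * b ∈ S) {x y : A} (hx : x ∈ Sat f S) (hy : y ∈ Sat f S) :
    x * y ∈ Sat f S := by
  obtain ⟨hf, γ, -, hγ1, hγ⟩ := hf
  obtain ⟨s₁, hs₁, t₁, ht₁, h₁⟩ := hx
  obtain ⟨s₂, hs₂, t₂, ht₂, h₂⟩ := hy
  refine ⟨s₁ * s₂, hS _ hs₁ _ hs₂, t₂ * t₁, hS _ ht₂ _ ht₁, ?_⟩
  have hadd := hf.2.2.1
  have hmul := hf.2.2.2.2
  have hp₁ : 0 < f s₁ := hf.pos (ne_of_mem_of_not_mem hs₁ h0)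
  have hp₂ : 0 < f s₂ := hf.pos (ne_of_mem_of_not_mem hs₂ h0)
  have e₁ := hf.map_eq_of_map_sub_lt h₁
  rw [hmul] at e₁
  have key : x * y * (t₂ * t₁) - s₁ * s₂ =
      x * (y * t₂ - s₂) * t₁ + (x * (s₂ * t₁ - t₁ * s₂) + (x * t₁ - s₁) * s₂) := by
    noncomm_ring
  rw [key, hmul s₁]
  refine (hadd _ _).trans_lt (max_lt ?_ ((hadd _ _).trans_lt (max_lt ?_ ?_)))
  · rw [hmul, hmul, mul_right_comm, e₁]
    gcongr
  · rw [hmul]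
    calc f x * f (s₂ * t₁ - t₁ * s₂) ≤ f x * (γ * f (s₂ * t₁)) :=
          mul_le_mul_of_nonneg_left (hγ _ _) (hf.1 _)
      _ = γ * (f s₁ * f s₂) := by rw [hmul, ← e₁]; ring
      _ < f s₁ * f s₂ := mul_lt_of_lt_one_left (mul_pos hp₁ hp₂) hγ1
  · rw [hmul]
    gcongr

theorem pow_mem_sat (hf : IsQuasiAbelian f) {S : Set A} (h1 : (1 : A) ∈ S) (h0 : (0 : A) ∉ S)
    (hS : ∀ a ∈ S, ∀ b ∈ S, a * b ∈ S) {x : A} (hx : x ∈ Sat f S) (n : ℕ) :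
    x ^ n ∈ Sat f S := by
  induction n with
  | zero => simpa using hf.1.one_mem_sat h1
  | succ n ih => rw [pow_succ]; exact hf.mul_mem_sat h0 hS ih hx

/-- An approximate right Ore condition, obtained by iterating commutators with `r`. -/
theorem exists_pow_ore (hf : IsQuasiAbelian f) {r : A} (hr : 0 < f r) (q : A) {δ : ℝ}
    (hδ : 0 < δ) : ∃ (n : ℕ) (q' : A), f (q * r ^ n - r * q') ≤ δ * f (r ^ n) := by
  obtain ⟨hf, γ, hγ0, hγ1, hγ⟩ := hf
  have hmul := hf.2.2.2.2
  have key (n : ℕ) : ∃ q', f (q * r ^ n - r * q') ≤ γ ^ n * f q * f (r ^ n) := by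
    induction n with
    | zero => exact ⟨0, by simp [hf.2.2.2.1]⟩
    | succ n ih =>
      obtain ⟨q', h⟩ := ih
      refine ⟨q' * r + (q * r ^ n - r * q'), ?_⟩
      have e : q * r ^ (n + 1) - r * (q' * r + (q * r ^ n - r * q')) =
          (q * r ^ n - r * q') * r - r * (q * r ^ n - r * q') := by
        rw [pow_succ]
        noncomm_ring
      rw [e]
      refine (hγ _ _).trans ?_
      rw [hmul, pow_succ r, hmul (r ^ n)]
      calc γ * (f (q * r ^ n - r * q') * f r) ≤ γ * (γ ^ n * f q * f (r ^ n) * f r) := by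
            gcongr
        _ = _ := by ring
  have hlim : Filter.Tendsto (fun n : ℕ => γ ^ n * f q) Filter.atTop (nhds 0) := by
    simpa using (tendsto_pow_atTop_nhds_zero_of_lt_one hγ0.le hγ1).mul_const (f q)
  obtain ⟨n, hn⟩ := (hlim.eventually_lt_const hδ).exists
  obtain ⟨q', h⟩ := key n
  exact ⟨n, q', h.trans (mul_le_mul_of_nonneg_right hn.le (hf.1 _))⟩

theorem dI_mul_le (hf : IsQuasiAbelian f) {S : Set A} (h1S : (1 : A) ∈ S)
    (h0S : (0 : A) ∉ S) (hS : ∀ a ∈ S, ∀ b ∈ S, a * b ∈ S) {ε M : ℝ} (hε0 : 0 ≤ ε)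
    (hε1 : ε < 1) {s t u v : A} (hs : s ∈ S) (ht : t ∈ S) (hu : u ∈ S) (hv : v ∈ S)
    {a b c d : A} (hM1 : 1 ≤ M) (hMa : f (a * t) / f s ≤ M) (hMb : f b / f t ≤ M)
    (hMc : f (c * v) / f u ≤ M) (hMd : f d / f v ≤ M)
    (h1 : dI f S (s, a * t) (u, c * v) ≤ ε) (h2 : dI f S (t, b) (v, d) ≤ ε) :
    dI f S (s, a * b) (u, c * d) ≤ ε * M := by
  have hpos {x : A} (hx : x ∈ S) : 0 < f x := hf.1.pos (ne_of_mem_of_not_mem hx h0S)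
  have hM : 0 < M := zero_lt_one.trans_le hM1
  rw [← div_le_iff₀ hM]
  refine le_of_forall_gt_imp_ge_of_dense fun ε' hε' => ?_
  obtain ⟨η, hη, hη'⟩ := exists_between (lt_min hε' hε1)
  obtain ⟨hηε, hη1⟩ := lt_min_iff.1 hη'
  refine le_trans ?_ hηε.le
  rw [div_le_iff₀ hM]
  have hη0 : 0 < η := hε0.trans_lt hη
  obtain ⟨⟨r, p⟩, hr, hsp, hup⟩ := hf.1.exists_delta_lt_of_dI_lt h1S (h1.trans_lt hη)
  obtain ⟨⟨w, q⟩, hw, htq, hvq⟩ := hf.1.exists_delta_lt_of_dI_lt h1S (h2.trans_lt hη)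
  have hr0 := hf.1.pos_of_mem_sat hr
  have hw0 := hf.1.pos_of_mem_sat hw
  obtain ⟨n, q', h3⟩ := hf.exists_pow_ore hr0 q (mul_pos hη0 hw0)
  have hrn := hf.pow_mem_sat h1S h0S hS hr n
  have hrn0 := hf.1.pos_of_mem_sat hrn
  exact hf.1.dI_le (ξ := (w * r ^ n, p * q')) (hf.mul_mem_sat h0S hS hw hrn)
    (hf.1.delta_mul_le (hpos hs) (hpos ht) hr0 hw0 hrn0 hη0.le hη1.le hM1 hMa hMb
      hsp.le htq.le h3)
    (hf.1.delta_mul_le (hpos hu) (hpos hv) hr0 hw0 hrn0 hη0.le hη1.le hM1 hMc hMd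
      hup.le hvq.le h3)

end IsQuasiAbelian

theorem statement8 {A : Type*} [Ring A] {m : ℕ} (hm : 0 < m)
    (f : Fin m → A → ℝ) (hf : ∀ i, IsQuasiAbelian (f i))
    (S : Set A) (h1S : (1 : A) ∈ S) (h0S : (0 : A) ∉ S)
    (hS : ∀ a ∈ S, ∀ b ∈ S, a * b ∈ S)
    (ε : ℝ) (hε0 : 0 < ε) (hε1 : ε < 1)
    (s t u v : A) (hs : s ∈ S) (ht : t ∈ S) (hu : u ∈ S) (hv : v ∈ S)
    (a b c d : A)
    (h1 : dGlob f S (s, a * t) (u, c * v) ≤ ε)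
    (h2 : dGlob f S (t, b) (v, d) ≤ ε) :
    dGlob f S (s, a * b) (u, c * d) ≤
      ε * ⨆ i : Fin m, max 1 (max (f i (a * t) / f i s)
        (max (f i (a * t) / f i s * (f i b / f i t))
        (max (f i b / f i t)
        (max (f i (c * v) / f i u)
        (max (f i (c * v) / f i u * (f i d / f i v)) (f i d / f i v)))))) := by
  have : Nonempty (Fin m) := ⟨⟨0, hm⟩⟩
  refine ciSup_le fun i => ?_
  have h1i := (le_ciSup (Set.finite_range fun i => dI (f i) S (s, a * t) (u, c * v)).bddAbove
    i).trans h1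
  have h2i := (le_ciSup (Set.finite_range fun i => dI (f i) S (t, b) (v, d)).bddAbove
    i).trans h2
  refine le_trans ?_ (mul_le_mul_of_nonneg_left
    (le_ciSup (Set.finite_range _).bddAbove i) hε0.le)
  exact (hf i).dI_mul_le h1S h0S hS hε0.le hε1 hs ht hu hv
    (by simp)
    (by simp)
    (by simp)
    (by simp)
    (by simp) h1i h2i
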